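/- Let q = p^m ≥ 3, s ≥ 1, χ ∈ F_q nonzero, G = χ·F_p, and suppose P ∈ F_q[T] is a G-fixed c-Wieferich prime of degree ps, so that P divides R_{q,s,α} = ∏_{i=1}^{s}(T^q − T − α^{q^i}) for some α ∈ F_{q^s} of degree s over F_q with Tr_{F_{q^s}/F_q}(α) ≠ 0 and F_{q,ps−1} ≡ 0 (mod T^q − T − α). Let k ≥ 0 be an integer with p not dividing 1 + sk, and set β = α − (k/(1+sk))·Tr_{F_{q^s}/F_q}(α), where k/(1+sk) is computed in the prime field F_p ⊆ F_q. Then every monic irreducible factor of R_{q,s,β} = ∏_{i=1}^{s}(T^q − T − β^{q^i}) in F_q[T] is a G-fixed irreducible polynomial of degree ps that is a c-Wieferich prime in F_{q^{1+sk}}[T], i.e., it divides F_{q^{1+sk}, ps−1}. -/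

import Mathlib

open Polynomial

/-- The sequence of polynomials `F_{Q,0} = 1`, `F_{Q,i} = (−1)^i + (T^{Q^i} − T)·F_{Q,i−1}`. -/
noncomputable def Fseq (q : ℕ) (K : Type*) [Field K] : ℕ → Polynomial K
  | 0 => 1
  | i + 1 => (-1 : Polynomial K) ^ (i + 1) + (X ^ q ^ (i + 1) - X) * Fseq q K i

theorem Fseq_map (q : ℕ) {K L : Type*} [Field K] [Field L] (f : K →+* L) (i : ℕ) :
    (Fseq q K i).map f = Fseq q L i := by
  induction i with
  | zero => simp [Fseq]
  | succ i ih => simp [Fseq, ih]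

theorem Fseq_eval_congr {q r : ℕ} {K : Type*} [Field K] {x y : K}
    (h : ∀ i, x ^ q ^ i - x = y ^ r ^ i - y) (i : ℕ) :
    (Fseq q K i).eval x = (Fseq r K i).eval y := by
  induction i with
  | zero => simp [Fseq]
  | succ i ih => simp [Fseq, ih, h]

theorem comp_X_add_C_eq_self_of_mem_closure {F : Type*} [Field F] {f : F[X]} {c : F} (h : f.comp (X + C c) = f)
    {a : F} (ha : a ∈ AddSubgroup.closure {c}) : f.comp (X + C a) = f := by
  induction ha using AddSubgroup.closure_induction with
  | mem x hx => rwa [Set.mem_singleton_iff.1 hx]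
  | zero => simp
  | add x y _ _ hx hy =>
    conv_rhs => rw [← hy, ← hx]
    simp [comp_assoc, add_assoc, add_comm (C y)]
  | neg x _ hx =>
    conv_lhs => rw [← hx]
    simp [comp_assoc]

theorem comp_X_add_C_eq_self_of_aeval_add_eq_zero {F L : Type*} [Field F] [Field L] [Algebra F L]
    {f : F[X]} (hf : Irreducible f) (hm : f.Monic) {c : F} {x : L} (hx : aeval x f = 0) (hxc : aeval (x + algebraMap F L c) f = 0) :
    f.comp (X + C c) = f := by
  refine eq_of_monic_of_dvd_of_natDegree_le hm (hm.comp_X_add_C c) ?_ (by simp [natDegree_comp])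
  rw [minpoly.eq_of_irreducible_of_monic hf hx hm, minpoly.dvd_iff,
    ← minpoly.eq_of_irreducible_of_monic hf hx hm]
  simpa [aeval_comp] using hxc

theorem sum_range_add_mul_pow_card {L : Type*} [CommRing L] {q s : ℕ} {x : L}
    (hx : x ^ q ^ s = x) (i j : ℕ) :
    ∑ l ∈ Finset.range (i + s * j), x ^ q ^ l =
      ∑ l ∈ Finset.range i, x ^ q ^ l +
        j * ∑ l ∈ Finset.range s, x ^ q ^ l := by
  induction j generalizing i with
  | zero => simp
  | succ j ih =>
    have h : i + s * (j + 1) = s + (i + s * j) := by ring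
    rw [h, Finset.sum_range_add]
    simp only [pow_add, pow_mul, hx, ih]
    push_cast
    ring

section FrobeniusPowers

variable {F L : Type*} [Field F] [Fintype F] [Field L] [Algebra F L]

theorem frobeniusAlgHom_pow_apply (n : ℕ) (x : L) :
    (FiniteField.frobeniusAlgHom F L ^ n) x = x ^ Fintype.card F ^ n := by
  rw [AlgHom.coe_pow, FiniteField.coe_frobeniusAlgHom, pow_iterate]

variable (F) in
theorem sub_pow_card_pow (n : ℕ) (x y : L) :
    (x - y) ^ Fintype.card F ^ n = x ^ Fintype.card F ^ n - y ^ Fintype.card F ^ n := by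
  simp only [← frobeniusAlgHom_pow_apply, map_sub]

theorem algebraMap_pow_card_pow (n : ℕ) (c : F) :
    algebraMap F L c ^ Fintype.card F ^ n = algebraMap F L c := by
  rw [← map_pow, FiniteField.pow_card_pow]

theorem aeval_pow_card_pow (n : ℕ) (x : L) (f : F[X]) :
    aeval (x ^ Fintype.card F ^ n) f = aeval x f ^ Fintype.card F ^ n := by
  rw [← frobeniusAlgHom_pow_apply, aeval_algHom_apply, frobeniusAlgHom_pow_apply]

variable (F) in
theorem pow_card_pow_sub_self (n : ℕ) (x : L) :
    x ^ Fintype.card F ^ n - x =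
      ∑ j ∈ Finset.range n, (x ^ Fintype.card F - x) ^ Fintype.card F ^ j := by
  induction n with
  | zero => simp
  | succ n ih =>
    rw [Finset.sum_range_succ, ← ih, sub_pow_card_pow, ← pow_mul, ← pow_succ']
    ring

theorem sum_range_sub_algebraMap_pow_card (n : ℕ) (x : L) (c : F) :
    ∑ l ∈ Finset.range n, (x - algebraMap F L c) ^ Fintype.card F ^ l =
      ∑ l ∈ Finset.range n, x ^ Fintype.card F ^ l - n * algebraMap F L c := by
  simp [sub_pow_card_pow, algebraMap_pow_card_pow]

theorem natDegree_minpoly_dvd_iff_pow_card_pow_eq {x : L} (hx : IsIntegral F x) (n : ℕ) :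
    (minpoly F x).natDegree ∣ n ↔ x ^ Fintype.card F ^ n = x := by
  rw [(minpoly.irreducible hx).natDegree_dvd_iff_dvd_X_pow_card_pow_sub_X, minpoly.dvd_iff,
    Nat.card_eq_fintype_card]
  simp [sub_eq_zero]

theorem exists_eq_pow_card_pow_of_aeval_eq_zero {f : F[X]} (hf : Irreducible f) {x y : L}
    (hx : aeval x f = 0) (hy : aeval y f = 0) : ∃ n, y = x ^ Fintype.card F ^ n := by
  have hxi : IsIntegral F x := (show IsAlgebraic F x from ⟨f, hf.ne_zero, hx⟩).isIntegral
  have hyi : IsIntegral F y := (show IsAlgebraic F y from ⟨f, hf.ne_zero, hy⟩).isIntegral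
  have : FiniteDimensional F (IntermediateField.adjoin F {x, y}) :=
    IntermediateField.finiteDimensional_adjoin (by rintro z (rfl | rfl) <;> assumption)
  have : Finite (IntermediateField.adjoin F {x, y}) := Module.finite_of_finite F
  let x' : IntermediateField.adjoin F {x, y} :=
    ⟨x, IntermediateField.subset_adjoin F _ (by simp)⟩
  let y' : IntermediateField.adjoin F {x, y} :=
    ⟨y, IntermediateField.subset_adjoin F _ (by simp)⟩
  have hconj : IsConjRoot F x y := by
    rw [isConjRoot_def, ← minpoly.eq_of_irreducible hf hx, ← minpoly.eq_of_irreducible hf hy]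
  have hconj' : IsConjRoot F x' y' :=
    (isConjRoot_algHom_iff (IntermediateField.adjoin F {x, y}).val).1 hconj
  obtain ⟨σ, hσ⟩ := hconj'.symm.exists_algEquiv
  obtain ⟨n, rfl⟩ := (FiniteField.bijective_frobeniusAlgEquivOfAlgebraic_pow F _).2 σ
  refine ⟨n, ?_⟩
  rw [AlgEquiv.coe_pow, FiniteField.coe_frobeniusAlgEquivOfAlgebraic_iterate] at hσ
  exact (congrArg Subtype.val hσ).symm

theorem pow_card_pow_eq_self_iff (p : ℕ) [CharP F p] {s : ℕ} {x y : L} {t : F}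
    (hxy : x ^ Fintype.card F - x = y) (hy : ∀ n, y ^ Fintype.card F ^ n = y ↔ s ∣ n)
    (ht : ∑ l ∈ Finset.range s, y ^ Fintype.card F ^ l = algebraMap F L t) (ht0 : t ≠ 0) (n : ℕ) :
    x ^ Fintype.card F ^ n = x ↔ p * s ∣ n := by
  have key (j : ℕ) : x ^ Fintype.card F ^ (s * j) = x ↔ p ∣ j := by
    have h := sum_range_add_mul_pow_card ((hy s).2 dvd_rfl) 0 j
    rw [← sub_eq_zero, pow_card_pow_sub_self, hxy, ← zero_add (s * j), h, ht, Finset.range_zero,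
      Finset.sum_empty, zero_add, ← map_natCast (algebraMap F L), ← map_mul, map_eq_zero, mul_eq_zero,
      or_iff_left ht0, CharP.cast_eq_zero_iff F p]
  constructor
  · intro h
    have hn : s ∣ n := by rw [← hy, ← hxy, sub_pow_card_pow, ← pow_mul, mul_comm, pow_mul, h]
    obtain ⟨j, rfl⟩ := hn
    rw [mul_comm]
    exact mul_dvd_mul_left s ((key j).1 h)
  · rintro ⟨j, rfl⟩
    rw [mul_comm p, mul_assoc]
    exact (key _).2 (dvd_mul_right p j)

theorem exists_root_of_map_dvd_prod {f : F[X]} (hf : Irreducible f) {s : ℕ} {x : L}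
    (hx : x ^ Fintype.card F ^ s = x)
    (hdvd : f.map (algebraMap F L) ∣ ∏ i ∈ Finset.range s,
      ((X : L[X]) ^ Fintype.card F - X - C (x ^ Fintype.card F ^ (i + 1)))) :
    ∃ y : AlgebraicClosure L, aeval y f = 0 ∧
      y ^ Fintype.card F - y = algebraMap L (AlgebraicClosure L) x := by
  obtain ⟨z, hz⟩ := IsAlgClosed.exists_aeval_eq_zero (AlgebraicClosure L) f
    (degree_pos_of_irreducible hf).ne'
  have h := aeval_eq_zero_of_dvd_aeval_eq_zero hdvd (x := z) (by rwa [aeval_map_algebraMap])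
  rw [map_prod, Finset.prod_eq_zero_iff] at h
  obtain ⟨i, hi, h⟩ := h
  rw [Finset.mem_range] at hi
  simp only [map_sub, map_pow, aeval_X, aeval_C, sub_eq_zero] at h
  refine ⟨z ^ Fintype.card F ^ (s - (i + 1)), ?_, ?_⟩
  · rw [aeval_pow_card_pow, hz, zero_pow (pow_pos Fintype.card_pos _).ne']
  · rw [← pow_mul, mul_comm, pow_mul, ← sub_pow_card_pow, h, ← pow_mul, ← pow_add,
      Nat.add_sub_cancel' hi, ← map_pow, hx]

end FrobeniusPowers

/-- Let `q = p^m ≥ 3`, `s ≥ 1`, `χ ∈ F_q` nonzero, `G = χ·F_p`, and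
suppose `P ∈ F_q[T]` is a `G`-fixed c-Wieferich prime of degree `ps`, dividing
`R_{q,s,α} = ∏_{i=1}^{s}(T^q − T − α^{q^i})` for some `α ∈ F_{q^s}` of degree `s` over
`F_q` with `Tr(α) ≠ 0` and `F_{q,ps−1} ≡ 0 (mod T^q − T − α)`.  Let `k ≥ 0` with
`p ∤ 1 + sk`, and set `β = α − (k/(1+sk))·Tr(α)` (the scalar computed in the prime
field `F_p ⊆ F_q`).  Then every monic irreducible factor of `R_{q,s,β}` in `F_q[T]` is
a `G`-fixed irreducible polynomial of degree `ps` which is a c-Wieferich prime in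
`F_{q^{1+sk}}[T]`, i.e. it divides `F_{q^{1+sk},ps−1}`. -/
theorem stmt12 (p m s k : ℕ) (hp : p.Prime) (hq3 : 3 ≤ p ^ m) (hs : 0 < s)
    (F Ks Kr : Type*) [Field F] [Fintype F]
    [Field Ks] [Fintype Ks] [Algebra F Ks] [Field Kr] [Fintype Kr] [Algebra F Kr]
    (hF : Fintype.card F = p ^ m) (hKs : Module.finrank F Ks = s)
    (hKr : Module.finrank F Kr = 1 + s * k)
    (χ : F) (hχ : χ ≠ 0)
    (P : Polynomial F) (hmon : P.Monic) (hirr : Irreducible P)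
    (hfix : ∀ a ∈ AddSubgroup.closure {χ}, P.comp (X + C a) = P)
    (hdeg : P.natDegree = p * s)
    (α : Ks) (hα : (minpoly F α).natDegree = s) (htr : Algebra.trace F Ks α ≠ 0)
    (hcong : ((X : Polynomial Ks) ^ p ^ m - X - C α) ∣ Fseq (p ^ m) Ks (p * s - 1))
    (hPdvd : P.map (algebraMap F Ks) ∣
      ∏ i ∈ Finset.range s,
        ((X : Polynomial Ks) ^ p ^ m - X - C (α ^ (p ^ m) ^ (i + 1))))
    (hk : ¬ p ∣ (1 + s * k))
    (β : Ks)
    (hβ : β = α - algebraMap F Ks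
      ((k : F) / ((1 + s * k : ℕ) : F) * Algebra.trace F Ks α)) :
    ∀ Q : Polynomial F, Q.Monic → Irreducible Q →
      Q.map (algebraMap F Ks) ∣
        ∏ i ∈ Finset.range s,
          ((X : Polynomial Ks) ^ p ^ m - X - C (β ^ (p ^ m) ^ (i + 1))) →
      (∀ a ∈ AddSubgroup.closure {χ}, Q.comp (X + C a) = Q) ∧ Q.natDegree = p * s ∧
        Q.map (algebraMap F Kr) ∣ Fseq ((p ^ m) ^ (1 + s * k)) Kr (p * s - 1) := by
  intro Q hQm hQ hQdvd
  have : Fact p.Prime := ⟨hp⟩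
  have : CharP F p := charP_of_card_eq_prime_pow hF
  rw [← hF] at hcong hPdvd hQdvd ⊢
  have hr : ((1 + s * k : ℕ) : F) ≠ 0 := by rwa [Ne, CharP.cast_eq_zero_iff F p]
  set t := Algebra.trace F Ks α
  set c : F := (k : F) / ((1 + s * k : ℕ) : F) * t with hc
  set τ : F := t / ((1 + s * k : ℕ) : F) with hτ
  have hτ0 : τ ≠ 0 := div_ne_zero htr hr
  have hcτ : c = k * τ := by rw [hc, hτ]; ring
  have htτ : t = ((1 + s * k : ℕ) : F) * τ := by rw [hτ]; field_simp
  have hαn (n : ℕ) : α ^ Fintype.card F ^ n = α ↔ s ∣ n := by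
    rw [← hα, natDegree_minpoly_dvd_iff_pow_card_pow_eq (.of_finite F α)]
  have hβn (n : ℕ) : β ^ Fintype.card F ^ n = β ↔ s ∣ n := by
    rw [hβ, sub_pow_card_pow, algebraMap_pow_card_pow, sub_left_inj, hαn]
  have hsumα : ∑ l ∈ Finset.range s, α ^ Fintype.card F ^ l = algebraMap F Ks t := by
    rw [FiniteField.algebraMap_trace_eq_sum_pow, hKs, Nat.card_eq_fintype_card]
  have hsumβ : ∑ l ∈ Finset.range s, β ^ Fintype.card F ^ l = algebraMap F Ks τ := by
    rw [hβ, sum_range_sub_algebraMap_pow_card, hsumα, ← map_natCast (algebraMap F Ks), ← map_mul,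
      ← map_sub, hcτ, htτ]
    congr 1
    push_cast
    ring
  have hlift {x : Ks} {y : F} (h : ∑ l ∈ Finset.range s, x ^ Fintype.card F ^ l = algebraMap F Ks y) :
      ∑ l ∈ Finset.range s, algebraMap Ks (AlgebraicClosure Ks) x ^ Fintype.card F ^ l = algebraMap F (AlgebraicClosure Ks) y := by
    simp only [← map_pow, ← map_sum, h, ← IsScalarTower.algebraMap_apply]
  obtain ⟨η, hPη, hη⟩ := exists_root_of_map_dvd_prod hirr ((hαn s).2 dvd_rfl) hPdvd
  obtain ⟨θ, hQθ, hθ⟩ := exists_root_of_map_dvd_prod hQ ((hβn s).2 dvd_rfl) hQdvd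
  set a := algebraMap Ks (AlgebraicClosure Ks) α with ha
  set b := algebraMap Ks (AlgebraicClosure Ks) β with hb
  have han (n : ℕ) : a ^ Fintype.card F ^ n = a ↔ s ∣ n := by
    rw [ha, ← map_pow, (algebraMap Ks (AlgebraicClosure Ks)).injective.eq_iff, hαn]
  have hbn (n : ℕ) : b ^ Fintype.card F ^ n = b ↔ s ∣ n := by
    rw [hb, ← map_pow, (algebraMap Ks (AlgebraicClosure Ks)).injective.eq_iff, hβn]
  have hbc : b = a - algebraMap F (AlgebraicClosure Ks) c := by
    rw [hb, hβ, map_sub, ← IsScalarTower.algebraMap_apply]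
  have hsa := hlift hsumα
  have hsb := hlift hsumβ
  have hθn (j : ℕ) : θ ^ Fintype.card F ^ (s * j) - θ = algebraMap F (AlgebraicClosure Ks) (j * τ) := by
    have h := sum_range_add_mul_pow_card ((hbn s).2 dvd_rfl) 0 j
    rw [zero_add, hsb] at h
    rw [pow_card_pow_sub_self, hθ, h]
    simp
  have hQmin : Q = minpoly F θ := minpoly.eq_of_irreducible_of_monic hQ hQθ hQm
  have hθint : IsIntegral F θ := ⟨Q, hQm, hQθ⟩
  refine ⟨fun x hx ↦ comp_X_add_C_eq_self_of_mem_closure ?_ hx, ?_, ?_⟩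
  · have hPχ : aeval (η + algebraMap F (AlgebraicClosure Ks) χ) P = 0 := by
      have h := congrArg (aeval η) (hfix χ (AddSubgroup.mem_closure_singleton_self χ))
      simpa [aeval_comp, hPη] using h
    obtain ⟨n, hn⟩ := exists_eq_pow_card_pow_of_aeval_eq_zero hirr hPη hPχ
    have hsn : s ∣ n := by
      rw [← han, ← hη, sub_pow_card_pow, ← pow_mul, mul_comm, pow_mul, ← hn]
      have h := algebraMap_pow_card_pow (L := (AlgebraicClosure Ks)) 1 χ
      rw [← pow_one (Fintype.card F), ← sub_eq_zero]
      have h' := map_add (FiniteField.frobeniusAlgHom F (AlgebraicClosure Ks) ^ 1) η (algebraMap F (AlgebraicClosure Ks) χ)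
      simp only [frobeniusAlgHom_pow_apply] at h'
      rw [h', h]
      ring
    obtain ⟨j, rfl⟩ := hsn
    have hχ' : χ = ((j * (1 + s * k) : ℕ) : F) * τ := by
      apply (algebraMap F (AlgebraicClosure Ks)).injective
      have h := sum_range_add_mul_pow_card ((han s).2 dvd_rfl) 0 j
      rw [zero_add, hsa] at h
      rw [← add_sub_cancel_left η (algebraMap F (AlgebraicClosure Ks) χ), hn, pow_card_pow_sub_self, hη, h, htτ]
      simp [mul_assoc]
    apply comp_X_add_C_eq_self_of_aeval_add_eq_zero hQ hQm hQθ
    rw [hχ', ← hθn, add_sub_cancel, aeval_pow_card_pow, hQθ,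
      zero_pow (pow_pos Fintype.card_pos _).ne']
  · refine Nat.dvd_right_iff_eq.1 fun n ↦ ?_
    rw [hQmin, natDegree_minpoly_dvd_iff_pow_card_pow_eq hθint,
      pow_card_pow_eq_self_iff p hθ hbn hsb hτ0]
  · rw [← Fseq_map _ (algebraMap F Kr), map_dvd_map', hQmin, minpoly.dvd_iff, aeval_def,
      ← eval_map, Fseq_map]
    have hshift (i : ℕ) : θ ^ (Fintype.card F ^ (1 + s * k)) ^ i - θ =
        η ^ Fintype.card F ^ i - η := by
      have h := sum_range_add_mul_pow_card ((hbn s).2 dvd_rfl) i (k * i)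
      rw [← pow_mul, pow_card_pow_sub_self, pow_card_pow_sub_self F i, hθ, hη,
        show (1 + s * k) * i = i + s * (k * i) by ring, h, hsb, hbc,
        sum_range_sub_algebraMap_pow_card, hcτ]
      push_cast
      ring
    rw [Fseq_eval_congr hshift]
    have h := eval_dvd (x := η) (Polynomial.map_dvd (algebraMap Ks (AlgebraicClosure Ks)) hcong)
    rw [Fseq_map] at h
    simpa [hη, sub_eq_zero, ha] using h
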